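/- The Gyftopoulos–Beretta entropy is sandwiched by the two non-equilibrium entropies: S₋(X) ≤ S_GB(X) ≤ S₊(X) for every X ∈ Ω. (Equation (26).) -/

import Mathlib

def lowerSet {Ω : Type*} (prec : Ω → Ω → Prop) (E : Set Ω) (S : Ω → ℝ) (X : Ω) : Set ℝ :=
  {s | ∃ Z ∈ E, prec Z X ∧ S Z = s}

def upperSet {Ω : Type*} (prec : Ω → Ω → Prop) (E : Set Ω) (S : Ω → ℝ) (X : Ω) : Set ℝ :=
  {s | ∃ Z ∈ E, prec X Z ∧ S Z = s}

noncomputable def Sminus {Ω : Type*} (prec : Ω → Ω → Prop) (E : Set Ω) (S : Ω → ℝ) (X : Ω) : ℝ :=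
  sSup (lowerSet prec E S X)

noncomputable def Splus {Ω : Type*} (prec : Ω → Ω → Prop) (E : Set Ω) (S : Ω → ℝ) (X : Ω) : ℝ :=
  sInf (upperSet prec E S X)

/-- The Gyftopoulos–Beretta entropy defined via the maximum work Φ. -/
noncomputable def SGB {Ω : Type*} (U : Ω → ℝ) (Φ : Ω → ℝ) (T₀ U₀ S₀ : ℝ) (X : Ω) : ℝ :=
  ((U X - U₀) - Φ X) / T₀ + S₀

/-- Eq. (26): S₋ ≤ S_GB ≤ S₊. -/
theorem stmt_13 {Ω : Type*} (prec : Ω → Ω → Prop) (E : Set Ω) (S : Ω → ℝ)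
    (U : Ω → ℝ) (Φ : Ω → ℝ) (T₀ U₀ S₀ : ℝ)
    (hT₀ : 0 < T₀)
    (TRANS : ∀ x y z : Ω, prec x y → prec y z → prec x z)
    (MONO : ∀ x ∈ E, ∀ y ∈ E, prec x y → S x ≤ S y)
    (N2 : ∀ X : Ω, ∃ X' ∈ E, ∃ X'' ∈ E, prec X' X ∧ prec X X'')
    (ATT : ∀ X : Ω, ∃ X' ∈ E, ∃ X'' ∈ E, prec X' X ∧ prec X X'' ∧
      S X' = Sminus prec E S X ∧ S X'' = Splus prec E S X)
    (WORK : ∀ X Y : Ω, prec X Y → Φ X ≥ (U X - U Y) + Φ Y)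
    (EQWORK : ∀ Z ∈ E, Φ Z = (U Z - U₀) - T₀ * (S Z - S₀)) :
    ∀ X : Ω, Sminus prec E S X ≤ SGB U Φ T₀ U₀ S₀ X ∧
      SGB U Φ T₀ U₀ S₀ X ≤ Splus prec E S X := by
  intro X
  obtain ⟨X', hX', X'', hX'', hlower, hupper, hminus, hplus⟩ := ATT X
  have h₁ := WORK X' X hlower
  have h₂ := WORK X X'' hupper
  rw [EQWORK X' hX'] at h₁
  rw [EQWORK X'' hX''] at h₂
  rw [← hminus, ← hplus, SGB]
  constructor
  · rw [← sub_le_iff_le_add, le_div_iff₀ hT₀]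
    linarith
  · rw [← le_sub_iff_add_le, div_le_iff₀ hT₀]
    linarith
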